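/- Let f : ℝⁿ → ℝ be differentiable, let θ > 0 and λ > 0, let x ∈ ℝⁿ, and let B ⊆ {1,…,n} be an index set. Suppose x⁺ is a global minimizer of the map z ↦ f(z) + λ‖z‖₀ + (θ/2)‖z − x‖₂² over the set {z ∈ ℝⁿ : z_i = x_i for every i ∉ B}. Then for every index i ∈ B with x⁺_i ≠ 0, the i-th partial derivative satisfies (∇f(x⁺))_i + θ(x⁺_i − x_i) = 0. -/

import Mathlib

open Classical in
/-- Number of nonzero components of a vector (the ℓ₀ pseudo-norm). -/
noncomputable def norm0 {n : ℕ} (x : EuclideanSpace ℝ (Fin n)) : ℕ :=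
  (Finset.univ.filter fun i => x i ≠ 0).card

/-- Moving along a coordinate in the support does not increase the number of nonzeros. -/
theorem norm0_add_smul_single_le {n : ℕ} {x : EuclideanSpace ℝ (Fin n)} {i : Fin n}
    (hi : x i ≠ 0) (t : ℝ) :
    norm0 (x + t • EuclideanSpace.single i (1 : ℝ)) ≤ norm0 x := by
  classical
  unfold norm0
  refine Finset.card_le_card fun j hj => ?_
  rw [Finset.mem_filter] at hj ⊢
  refine ⟨Finset.mem_univ j, ?_⟩
  rcases eq_or_ne j i with rfl | hji
  · exact hi
  · simpa [hji] using hj.2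

/-- First-order optimality condition (eq. (11)) on the nonzero support of the solution
of the proximal block subproblem for the sparse regularized problem. -/
theorem subproblem_optimality_regu {n : ℕ} (f : EuclideanSpace ℝ (Fin n) → ℝ)
    (f' : EuclideanSpace ℝ (Fin n) → EuclideanSpace ℝ (Fin n))
    (hgrad : ∀ y, HasGradientAt f (f' y) y)
    (θ lam : ℝ) (hθ : 0 < θ) (hlam : 0 < lam)
    (x xp : EuclideanSpace ℝ (Fin n)) (B : Finset (Fin n))
    (hfeas : ∀ i ∉ B, xp i = x i)
    (hmin : ∀ z : EuclideanSpace ℝ (Fin n), (∀ i ∉ B, z i = x i) →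
      f xp + lam * norm0 xp + θ / 2 * ‖xp - x‖ ^ 2 ≤
        f z + lam * norm0 z + θ / 2 * ‖z - x‖ ^ 2) :
    ∀ i ∈ B, xp i ≠ 0 → f' xp i + θ * (xp i - x i) = 0 := by
  intro i hi hxi
  set e : EuclideanSpace ℝ (Fin n) := EuclideanSpace.single i (1 : ℝ) with he
  have hline : HasDerivAt (fun t : ℝ => xp + t • e) e 0 := by
    simpa using ((hasDerivAt_id (0 : ℝ)).smul_const e).const_add xp
  have hf : HasDerivAt (fun t : ℝ => f (xp + t • e)) (inner ℝ (f' xp) e) 0 := by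
    have hf' : HasFDerivAt f (InnerProductSpace.toDual ℝ _ (f' xp)) (xp + (0 : ℝ) • e) := by
      simpa using (hgrad xp).hasFDerivAt
    exact hf'.comp_hasDerivAt (0 : ℝ) hline
  have hsq : HasDerivAt (fun t : ℝ => θ / 2 * ‖xp + t • e - x‖ ^ 2)
      (θ / 2 * (2 * inner ℝ (xp - x) e)) 0 := by
    simpa using ((hline.sub_const x).norm_sq).const_mul (θ / 2)
  have hlocal : IsLocalMin
      (fun t : ℝ => f (xp + t • e) + θ / 2 * ‖xp + t • e - x‖ ^ 2) 0 := by
    refine Filter.Eventually.of_forall fun t => ?_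
    have hfeas_line : ∀ j ∉ B, (xp + t • e) j = x j := fun j hj => by
      have hji : j ≠ i := fun h => hj (h ▸ hi)
      simp [he, hji, hfeas j hj]
    have hcard : lam * (norm0 (xp + t • e) : ℝ) ≤ lam * norm0 xp :=
      mul_le_mul_of_nonneg_left (by exact_mod_cast norm0_add_smul_single_le hxi t) hlam.le
    have hle := hmin _ hfeas_line
    simp only [zero_smul, add_zero]
    linarith
  have hzero := hlocal.hasDerivAt_eq_zero (hf.add hsq)
  simp only [he, EuclideanSpace.inner_single_right, PiLp.sub_apply, conj_trivial, one_mul]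
    at hzero
  linarith
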